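/- Let E₈ denote the E₈ lattice in ℝ⁸, and let T = ℤ-span of {(1,3,0,0,0,0,0,0), (1/2,3/2,5/2,−1/2,−1/2,−1/2,−1/2,−1/2)} ⊆ E₈. Then the orthogonal complement T⊥ = {x ∈ E₈ : ⟨x,t⟩ = 0 for all t ∈ T} equals the ℤ-span of the six vectors (0,0,0,1,−1,0,0,0), (0,0,0,0,1,−1,0,0), (0,0,0,0,0,1,−1,0), (0,0,0,0,0,0,1,−1), (0,0,1,1,1,1,1,1), (3/2,−1/2,1/2,1/2,1/2,1/2,1/2,1/2), and the determinant of the Gram matrix of these six vectors equals 75. -/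

import Mathlib

open scoped RealInnerProductSpace

/-- The `E₈` lattice: vectors of `ℝ⁸` whose coordinates are all integers or all
half-integers, and whose coordinate sum is an even integer. -/
def E8Lattice : Set (EuclideanSpace ℝ (Fin 8)) :=
  {x | ((∀ i, ∃ k : ℤ, x i = (k : ℝ)) ∨ (∀ i, ∃ k : ℤ, x i = (k : ℝ) + 1 / 2)) ∧
    ∃ m : ℤ, (∑ i, x i) = 2 * (m : ℝ)}

/-- A vector of `ℝ⁸` as an element of `EuclideanSpace ℝ (Fin 8)`. -/
noncomputable def e8vec (v : Fin 8 → ℝ) : EuclideanSpace ℝ (Fin 8) :=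
  (WithLp.equiv 2 (Fin 8 → ℝ)).symm v

theorem inner_e8vec (x : EuclideanSpace ℝ (Fin 8)) (v : Fin 8 → ℝ) :
    ⟪x, e8vec v⟫ = ∑ i, x i * v i := by
  simp [e8vec, PiLp.inner_apply, mul_comm]

theorem e8vec_apply (v : Fin 8 → ℝ) (i : Fin 8) : e8vec v i = v i := rfl

theorem forall_mem_span_int_inner_eq_zero_iff {E : Type*} [NormedAddCommGroup E]
    [InnerProductSpace ℝ E] (s : Set E) (x : E) :
    (∀ t ∈ Submodule.span ℤ s, ⟪x, t⟫ = 0) ↔ ∀ t ∈ s, ⟪x, t⟫ = 0 := by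
  refine ⟨fun h t ht => h t (Submodule.subset_span ht), fun h t ht => ?_⟩
  induction ht using Submodule.span_induction with
  | mem t ht => exact h t ht
  | zero => exact inner_zero_right x
  | add a b _ _ ha hb => rw [inner_add_right, ha, hb, add_zero]
  | smul n a _ ha => rw [← Int.cast_smul_eq_zsmul ℝ, inner_smul_right, ha, mul_zero]

/-- Two coordinates of a vector of `E₈` differ by an integer. -/
theorem E8Lattice.exists_int_sub {x : EuclideanSpace ℝ (Fin 8)} (hx : x ∈ E8Lattice)
    (i j : Fin 8) : ∃ k : ℤ, x i - x j = k := by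
  obtain ⟨h | h, -⟩ := hx <;> obtain ⟨a, ha⟩ := h i <;> obtain ⟨b, hb⟩ := h j <;>
    exact ⟨a - b, by rw [ha, hb]; push_cast; ring⟩

/-- Twice a coordinate of a vector of `E₈` is an integer. -/
theorem E8Lattice.exists_int_two_mul {x : EuclideanSpace ℝ (Fin 8)} (hx : x ∈ E8Lattice)
    (i : Fin 8) : ∃ k : ℤ, 2 * x i = k := by
  obtain ⟨h | h, -⟩ := hx <;> obtain ⟨a, ha⟩ := h i
  · exact ⟨2 * a, by rw [ha]; push_cast; ring⟩
  · exact ⟨2 * a + 1, by rw [ha]; push_cast; ring⟩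

/-- A vector whose coordinates all differ from half a fixed integer by integers, and whose
coordinate sum is even, lies in `E₈`. -/
theorem mem_E8Lattice_of_sub_half {x : EuclideanSpace ℝ (Fin 8)} (n : ℤ)
    (h : ∀ i, ∃ k : ℤ, x i = k + n / 2) (hs : ∃ m : ℤ, ∑ i, x i = 2 * (m : ℝ)) :
    x ∈ E8Lattice := by
  refine ⟨?_, hs⟩
  obtain ⟨r, rfl | rfl⟩ := Int.even_or_odd' n
  · refine Or.inl fun i => ?_
    obtain ⟨k, hk⟩ := h i
    exact ⟨k + r, by rw [hk]; push_cast; ring⟩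
  · refine Or.inr fun i => ?_
    obtain ⟨k, hk⟩ := h i
    exact ⟨k + r, by rw [hk]; push_cast; ring⟩

/-- With `T = span_ℤ {(1,3,0,…,0), (1/2,3/2,5/2,−1/2,…,−1/2)} ⊆ E₈`, the
orthogonal complement `T⊥ = {x ∈ E₈ : ⟪x,t⟫ = 0 ∀ t ∈ T}` is the `ℤ`-span of the given
six vectors, whose Gram determinant equals `75`. -/
theorem orthCompl_T555_in_E8 :
    {x | x ∈ E8Lattice ∧ ∀ t ∈ Submodule.span ℤ
        ({e8vec ![1, 3, 0, 0, 0, 0, 0, 0],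
          e8vec ![1/2, 3/2, 5/2, -(1/2), -(1/2), -(1/2), -(1/2), -(1/2)]} :
            Set (EuclideanSpace ℝ (Fin 8))), ⟪x, t⟫ = 0} =
      (Submodule.span ℤ (Set.range
        ![e8vec ![0, 0, 0, 1, -1, 0, 0, 0],
          e8vec ![0, 0, 0, 0, 1, -1, 0, 0],
          e8vec ![0, 0, 0, 0, 0, 1, -1, 0],
          e8vec ![0, 0, 0, 0, 0, 0, 1, -1],
          e8vec ![0, 0, 1, 1, 1, 1, 1, 1],
          e8vec ![3/2, -(1/2), 1/2, 1/2, 1/2, 1/2, 1/2, 1/2]]) :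
        Set (EuclideanSpace ℝ (Fin 8))) ∧
    Matrix.det (Matrix.of fun i j =>
      ⟪(![e8vec ![0, 0, 0, 1, -1, 0, 0, 0],
          e8vec ![0, 0, 0, 0, 1, -1, 0, 0],
          e8vec ![0, 0, 0, 0, 0, 1, -1, 0],
          e8vec ![0, 0, 0, 0, 0, 0, 1, -1],
          e8vec ![0, 0, 1, 1, 1, 1, 1, 1],
          e8vec ![3/2, -(1/2), 1/2, 1/2, 1/2, 1/2, 1/2, 1/2]] : Fin 6 → _) i,
        (![e8vec ![0, 0, 0, 1, -1, 0, 0, 0],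
          e8vec ![0, 0, 0, 0, 1, -1, 0, 0],
          e8vec ![0, 0, 0, 0, 0, 1, -1, 0],
          e8vec ![0, 0, 0, 0, 0, 0, 1, -1],
          e8vec ![0, 0, 1, 1, 1, 1, 1, 1],
          e8vec ![3/2, -(1/2), 1/2, 1/2, 1/2, 1/2, 1/2, 1/2]] : Fin 6 → _) j⟫) = 75 := by
  constructor
  · ext x
    simp only [Set.mem_ofPred_eq, SetLike.mem_coe, forall_mem_span_int_inner_eq_zero_iff,
      Submodule.mem_span_range_iff_exists_fun, Set.mem_insert_iff, Set.mem_singleton_iff,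
      forall_eq_or_imp, forall_eq, inner_e8vec]
    constructor
    · rintro ⟨hx, h₁, h₂⟩
      simp [Fin.sum_univ_succ] at h₁ h₂
      obtain ⟨a, ha⟩ := E8Lattice.exists_int_sub hx 3 2
      obtain ⟨b, hb⟩ := E8Lattice.exists_int_sub hx 4 2
      obtain ⟨c, hc⟩ := E8Lattice.exists_int_sub hx 5 2
      obtain ⟨d, hd⟩ := E8Lattice.exists_int_sub hx 6 2
      obtain ⟨e, he⟩ := E8Lattice.exists_int_sub hx 2 1
      obtain ⟨f, hf⟩ := E8Lattice.exists_int_two_mul hx 1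
      refine ⟨![a, a + b, a + b + c, a + b + c + d, e + f, -f], ?_⟩
      ext i
      fin_cases i <;>
        simp [Fin.sum_univ_succ, e8vec_apply, ← Int.cast_smul_eq_zsmul ℝ] <;> linarith
    · rintro ⟨c, rfl⟩
      refine ⟨mem_E8Lattice_of_sub_half (c 5) (fun i => ?_) ⟨3 * c 4 + 2 * c 5, ?_⟩, ?_, ?_⟩
      · refine ⟨![c 5, -c 5, c 4, c 0 + c 4, c 1 - c 0 + c 4, c 2 - c 1 + c 4, c 3 - c 2 + c 4,
          c 4 - c 3] i, ?_⟩
        fin_cases i <;>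
          simp [Fin.sum_univ_six, e8vec_apply, ← Int.cast_smul_eq_zsmul ℝ] <;> ring
      all_goals
        simp [Fin.sum_univ_six, Fin.sum_univ_eight, e8vec_apply, ← Int.cast_smul_eq_zsmul ℝ]
        ring
  · trans Matrix.det (!![2, -1, 0, 0, 0, 0; -1, 2, -1, 0, 0, 0; 0, -1, 2, -1, 0, 0;
        0, 0, -1, 2, 0, 0; 0, 0, 0, 0, 6, 3; 0, 0, 0, 0, 3, 4] : Matrix (Fin 6) (Fin 6) ℝ)
    · congr 1
      ext i j
      fin_cases i <;> fin_cases j <;>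
        simp [inner_e8vec, e8vec_apply, Fin.sum_univ_eight, EuclideanSpace.real_norm_sq_eq] <;> norm_num
    · simp [Matrix.det_succ_row_zero, Fin.sum_univ_succ, Fin.succAbove]
      norm_num
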